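/- arXiv:2211.10902 — 2 statements merged into one kernel-verified Lean document; each statement's English description precedes it below -/
import Mathlib

section
/- Let H and U be finite types and let μ : H × U → ℝ be a probability mass function on H × U. Define the marginal μ_H : H → ℝ by μ_H h = ∑ u, μ (h, u). Let g : H → U → ℝ be a predictor such that for every h, g h is a probability mass function on U, and g h u > 0 whenever μ (h, u) > 0. If the expected negative log-likelihood of g attains the Bayes-optimal value, i.e. −∑ h, ∑ u, μ (h, u) * Real.log (g h u) = −∑ h, ∑ u, μ (h, u) * Real.log (μ (h, u) / μ_H h), then for every h : H with μ_H h > 0 and every u : U, g h u = μ (h, u) / μ_H h. (Uniqueness part of Theorem 1's first half: a global minimizer of the negative log-likelihood loss equals the ground-truth posterior belief over Reward Machine states on every history of positive probability.) -/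
/-- Uniqueness part of Theorem 1's first half: a global minimizer of the negative
log-likelihood loss equals the ground-truth posterior belief over RM states on
every history of positive probability. -/
theorem bayes_optimal_belief_unique {H U : Type*} [Fintype H] [Fintype U]
    (μ : H × U → ℝ)
    (hμ_nonneg : ∀ x, 0 ≤ μ x) (hμ_sum : ∑ x, μ x = 1)
    (μH : H → ℝ) (hμH : ∀ h, μH h = ∑ u, μ (h, u))
    (g : H → U → ℝ)
    (hg_nonneg : ∀ h u, 0 ≤ g h u) (hg_sum : ∀ h, ∑ u, g h u = 1)
    (hg_pos : ∀ h u, 0 < μ (h, u) → 0 < g h u)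
    (h_eq : -∑ h, ∑ u, μ (h, u) * Real.log (g h u) =
      -∑ h, ∑ u, μ (h, u) * Real.log (μ (h, u) / μH h)) :
    ∀ h, 0 < μH h → ∀ u, g h u = μ (h, u) / μH h := by
  have hH_nonneg : ∀ h, 0 ≤ μH h := fun h => by
    rw [hμH]; exact Finset.sum_nonneg fun u _ => hμ_nonneg _
  have hle : ∀ h u, μ (h, u) ≤ μH h := fun h u => by
    rw [hμH]
    exact Finset.single_le_sum (f := fun u => μ (h, u)) (fun u _ => hμ_nonneg _)
      (Finset.mem_univ u)
  let D : H → U → ℝ := fun h u => μH h * g h u - μ (h, u)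
    - (μ (h, u) * Real.log (g h u) - μ (h, u) * Real.log (μ (h, u) / μH h))
  have key : ∀ h u, 0 < μ (h, u) → D h u = μ (h, u) *
      ((g h u / (μ (h, u) / μH h)) - 1 - Real.log (g h u / (μ (h, u) / μH h))) := by
    intro h u hp
    have hH : 0 < μH h := lt_of_lt_of_le hp (hle h u)
    have hg := hg_pos h u hp
    rw [Real.log_div hg.ne' (div_pos hp hH).ne']
    simp only [D]
    field_simp
  have hD : ∀ h u, 0 ≤ D h u := by
    intro h u
    rcases (hμ_nonneg (h, u)).eq_or_lt with h0 | hp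
    · simp only [D, ← h0]
      have := mul_nonneg (hH_nonneg h) (hg_nonneg h u)
      simpa using this
    · have hH : 0 < μH h := lt_of_lt_of_le hp (hle h u)
      rw [key h u hp]
      have := Real.log_le_sub_one_of_pos (div_pos (hg_pos h u hp) (div_pos hp hH))
      exact mul_nonneg hp.le (by linarith)
  have hsum : ∑ h, ∑ u, D h u = 0 := by
    simp only [D, Finset.sum_sub_distrib, ← Finset.mul_sum, hg_sum, ← hμH, mul_one]
    linarith
  intro h hH u
  have h1 := (Finset.sum_eq_zero_iff_of_nonneg
    (fun h _ => Finset.sum_nonneg fun u _ => hD h u)).1 hsum h (Finset.mem_univ h)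
  have h2 := (Finset.sum_eq_zero_iff_of_nonneg (fun u _ => hD h u)).1 h1 u (Finset.mem_univ u)
  rcases (hμ_nonneg (h, u)).eq_or_lt with h0 | hp
  · simp only [D, ← h0] at h2
    rw [← h0]
    simpa [hH.ne'] using h2
  · rw [key h u hp] at h2
    by_contra hne
    have hq := div_pos hp hH
    have := Real.log_lt_sub_one_of_pos (div_pos (hg_pos h u hp) hq)
      (fun hx => hne ((div_eq_one_iff_eq hq.ne').1 hx))
    have := mul_pos hp (sub_pos.2 this)
    linarith
end

section
/- Let ε : ℕ → ℝ be a sequence with 0 ≤ ε t ≤ 1 for all t, and define b : ℕ → ℝ by b 0 = 0 and b (t+1) = b t + (1 − b t) * ε t. If there exists a constant c with 0 < c ≤ 1 such that ε t ≥ c for all t, then b t tends to 1 as t → ∞. (Independent Belief Updating, when every per-step proposition probability is bounded away from zero, eventually predicts with probability approaching 1 that the proposition has held, regardless of the truth.) -/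
/-- Independent Belief Updating, when every per-step proposition probability is
bounded away from zero, predicts with probability approaching 1 that the
proposition has held. -/
theorem belief_updating_tendsto_one (ε : ℕ → ℝ) (hε : ∀ t, 0 ≤ ε t ∧ ε t ≤ 1)
    (b : ℕ → ℝ) (hb0 : b 0 = 0)
    (hb : ∀ t, b (t + 1) = b t + (1 - b t) * ε t)
    (c : ℝ) (hc0 : 0 < c) (hc1 : c ≤ 1) (hεc : ∀ t, c ≤ ε t) :
    Filter.Tendsto b Filter.atTop (nhds 1) := by
  have key : ∀ t, 0 ≤ 1 - b t ∧ 1 - b t ≤ (1 - c) ^ t := by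
    intro t
    induction t with
    | zero => simp [hb0]
    | succ t ih =>
      obtain ⟨h0, h1⟩ := ih
      have e : 1 - b (t + 1) = (1 - b t) * (1 - ε t) := by rw [hb]; ring
      have h2 : 0 ≤ 1 - ε t := by linarith [(hε t).2]
      have h3 : 1 - ε t ≤ 1 - c := by linarith [hεc t]
      rw [e, pow_succ]
      exact ⟨mul_nonneg h0 h2, mul_le_mul h1 h3 h2 (h0.trans h1)⟩
  have hp : Filter.Tendsto (fun t : ℕ => (1 - c) ^ t) Filter.atTop (nhds 0) :=
    tendsto_pow_atTop_nhds_zero_of_lt_one (by linarith) (by linarith)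
  have h := squeeze_zero (fun t => (key t).1) (fun t => (key t).2) hp
  have h' := h.const_sub 1
  simpa using h'
end
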